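/- Let n ∈ ℕ and let φ : ℝ → ℝ be eventually (n+1)-times differentiable (i.e., there exists X > 0 such that φ is (n+1)-times differentiable on (X, ∞) and on (−∞, −X)). If the n-th derivative φ^{(n)} is eventually monotone, then the n-th difference Δⁿ₁[φ] with step 1 is eventually monotone. -/

import Mathlib

open MeasureTheory Set Filter

noncomputable section

/-- The first difference operator with step `ϱ`. -/
def DeltaOp (ϱ : ℝ) (f : ℝ → ℝ) : ℝ → ℝ := fun x => f (x + ϱ) - f x

/-- The `n`-th difference operator with step `ϱ` (iterate of the first difference). -/
def DeltaIter (n : ℕ) (ϱ : ℝ) (f : ℝ → ℝ) : ℝ → ℝ := (DeltaOp ϱ)^[n] f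

/-- `f` is monotone (nondecreasing or nonincreasing) on `s`. -/
def MonoOrAntiOn (f : ℝ → ℝ) (s : Set ℝ) : Prop :=
  MonotoneOn f s ∨ AntitoneOn f s

/-- `f` is eventually monotone. -/
def EventuallyMonotoneFn (f : ℝ → ℝ) : Prop :=
  ∃ X > (0 : ℝ), MonoOrAntiOn f (Ioi X) ∧ MonoOrAntiOn f (Iio (-X))

theorem MonoOrAntiOn.mono {f : ℝ → ℝ} {s t : Set ℝ} (h : MonoOrAntiOn f s) (hts : t ⊆ s) :
    MonoOrAntiOn f t :=
  h.imp (fun h => h.mono hts) (fun h => h.mono hts)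

theorem HasDerivAt.deltaOp {f : ℝ → ℝ} {ϱ x a b : ℝ} (ha : HasDerivAt f a x)
    (hb : HasDerivAt f b (x + ϱ)) : HasDerivAt (DeltaOp ϱ f) (b - a) x :=
  (hb.comp_add_const x ϱ).sub ha

/-- If the derivative of `f` is monotone on a convex set, so is the first difference of `f`
on the points that a nonnegative step keeps in that set. -/
theorem MonoOrAntiOn.deltaOp {f f' : ℝ → ℝ} {s : Set ℝ} {ϱ : ℝ} (hϱ : 0 ≤ ϱ) (hs : Convex ℝ s)
    (hf : ∀ x ∈ s, HasDerivAt f (f' x) x) (hf' : MonoOrAntiOn f' s) :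
    MonoOrAntiOn (DeltaOp ϱ f) (s ∩ (fun x => x + ϱ) ⁻¹' s) := by
  have hconv : Convex ℝ (s ∩ (fun x => x + ϱ) ⁻¹' s) := hs.inter (hs.translate_preimage_left ϱ)
  have hderiv : ∀ x ∈ s ∩ (fun x => x + ϱ) ⁻¹' s,
      HasDerivAt (DeltaOp ϱ f) (f' (x + ϱ) - f' x) x :=
    fun x hx => (hf x hx.1).deltaOp (hf _ hx.2)
  have hcont : ContinuousOn (DeltaOp ϱ f) (s ∩ (fun x => x + ϱ) ⁻¹' s) :=
    fun x hx => (hderiv x hx).continuousAt.continuousWithinAt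
  have hint : ∀ x ∈ interior (s ∩ (fun x => x + ϱ) ⁻¹' s),
      HasDerivWithinAt (DeltaOp ϱ f) (f' (x + ϱ) - f' x)
        (interior (s ∩ (fun x => x + ϱ) ⁻¹' s)) x :=
    fun x hx => (hderiv x (interior_subset hx)).hasDerivWithinAt
  rcases hf' with h | h
  · refine Or.inl (monotoneOn_of_hasDerivWithinAt_nonneg hconv hcont hint fun x hx => ?_)
    obtain ⟨h₁, h₂⟩ := interior_subset hx
    exact sub_nonneg.2 (h h₁ h₂ (le_add_of_nonneg_right hϱ))
  · refine Or.inr (antitoneOn_of_hasDerivWithinAt_nonpos hconv hcont hint fun x hx => ?_)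
    obtain ⟨h₁, h₂⟩ := interior_subset hx
    exact sub_nonpos.2 (h h₁ h₂ (le_add_of_nonneg_right hϱ))

/-- If `g 0, …, g n` are successive derivatives on a convex set and `g n` is monotone there, then
the `n`-th difference of `g 0` is monotone on every set whose first `n` translates by a nonnegative
step stay in that convex set. -/
theorem MonoOrAntiOn.deltaIter {ϱ : ℝ} (hϱ : 0 ≤ ϱ) (n : ℕ) (g : ℕ → ℝ → ℝ) {s t : Set ℝ}
    (hs : Convex ℝ s) (hg : ∀ k < n, ∀ x ∈ s, HasDerivAt (g k) (g (k + 1) x) x)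
    (hmono : MonoOrAntiOn (g n) s) (ht : ∀ x ∈ t, ∀ j ≤ n, x + j * ϱ ∈ s) :
    MonoOrAntiOn (DeltaIter n ϱ (g 0)) t := by
  induction n generalizing g s with
  | zero => exact hmono.mono fun x hx => by simpa using ht x hx 0 le_rfl
  | succ n ih =>
    refine ih (fun k => DeltaOp ϱ (g k)) (hs.inter (hs.translate_preimage_left ϱ))
      (fun k hk x hx => (hg k (by lia) x hx.1).deltaOp (hg k (by lia) _ hx.2))
      (MonoOrAntiOn.deltaOp hϱ hs (hg n n.lt_succ_self) hmono)
      fun x hx j hj => ⟨ht x hx j (by lia), ?_⟩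
    have := ht x hx (j + 1) (by lia)
    push_cast at this
    rwa [add_mul, one_mul, ← add_assoc] at this

theorem hasDerivAt_iteratedDeriv {f : ℝ → ℝ} {s : Set ℝ} (hs : IsOpen s) {k : ℕ}
    (h : DifferentiableOn ℝ (iteratedDeriv k f) s) {x : ℝ} (hx : x ∈ s) :
    HasDerivAt (iteratedDeriv k f) (iteratedDeriv (k + 1) f x) x := by
  rw [iteratedDeriv_succ]
  exact (h.differentiableAt (hs.mem_nhds hx)).hasDerivAt

theorem delta_eventually_monotone (n : ℕ) (φ : ℝ → ℝ)
    (hdiff : ∃ X > (0 : ℝ),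
      (∀ k ≤ n, DifferentiableOn ℝ (iteratedDeriv k φ) (Ioi X)) ∧
      (∀ k ≤ n, DifferentiableOn ℝ (iteratedDeriv k φ) (Iio (-X))))
    (hmono : EventuallyMonotoneFn (iteratedDeriv n φ)) :
    EventuallyMonotoneFn (DeltaIter n 1 φ) := by
  obtain ⟨X, hX, hright, hleft⟩ := hdiff
  obtain ⟨Y, hY, mright, mleft⟩ := hmono
  have hXY : X ≤ max X Y := le_max_left X Y
  have hYX : Y ≤ max X Y := le_max_right X Y
  refine ⟨max X Y + n, by positivity, ?_, ?_⟩
  · rw [← iteratedDeriv_zero (f := φ)]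
    refine MonoOrAntiOn.deltaIter zero_le_one n (fun k => iteratedDeriv k φ)
      (convex_Ioi (max X Y))
      (fun k hk x hx => hasDerivAt_iteratedDeriv isOpen_Ioi (hright k hk.le)
        (Ioi_subset_Ioi hXY hx))
      (mright.mono (Ioi_subset_Ioi hYX)) fun x hx j _ => ?_
    simp only [mem_Ioi, mul_one] at hx ⊢
    linarith [j.cast_nonneg (α := ℝ), n.cast_nonneg (α := ℝ)]
  · rw [← iteratedDeriv_zero (f := φ)]
    refine MonoOrAntiOn.deltaIter zero_le_one n (fun k => iteratedDeriv k φ)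
      (convex_Iio (-max X Y))
      (fun k hk x hx => hasDerivAt_iteratedDeriv isOpen_Iio (hleft k hk.le)
        (Iio_subset_Iio (neg_le_neg hXY) hx))
      (mleft.mono (Iio_subset_Iio (neg_le_neg hYX))) fun x hx j hj => ?_
    have hj' : (j : ℝ) ≤ n := by exact_mod_cast hj
    simp only [mem_Iio, mul_one] at hx ⊢
    linarith
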